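/- Let n ≥ 1, q > 1, and let μ be a probability measure on ℝⁿ with finite first moment, zero barycenter, and not supported on any affine hyperplane. If ρ̄ ∈ P_1(ℝⁿ) minimizes J(ρ) = F(ρ) + T(ρ,μ) over P_1(ℝⁿ), then the absolutely continuous part ρ̄^ac of ρ̄ is not zero almost everywhere; equivalently, ρ̄ is not singular with respect to Lebesgue measure. -/

import Mathlib

open MeasureTheory Topology Filter Set
open scoped ENNReal RealInnerProductSpace

noncomputable section

abbrev En (n : ℕ) : Type := EuclideanSpace ℝ (Fin n)

/-- The positive part of an extended real number, as an element of `ℝ≥0∞`. -/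
def posPartNN (x : EReal) : ℝ≥0∞ := if x = ⊤ then ⊤ else ENNReal.ofReal x.toReal

/-- The integral of an `EReal`-valued function, with values in `EReal`
(defined as the integral of the positive part minus that of the negative part). -/
def eInt {X : Type*} [MeasurableSpace X] (ρ : Measure X) (g : X → EReal) : EReal :=
  ((∫⁻ x, posPartNN (g x) ∂ρ : ℝ≥0∞) : EReal) - ((∫⁻ x, posPartNN (-(g x)) ∂ρ : ℝ≥0∞) : EReal)

/-- Transport plans between `ρ` and `μ`. -/
def Plans {n : ℕ} (ρ μ : Measure (En n)) : Set (Measure (En n × En n)) :=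
  {γ | IsProbabilityMeasure γ ∧ γ.map Prod.fst = ρ ∧ γ.map Prod.snd = μ}

/-- The maximal correlation functional `T(ρ,μ)`. -/
def Tcorr {n : ℕ} (ρ μ : Measure (En n)) : EReal :=
  ⨆ γ ∈ Plans ρ μ, eInt γ (fun p => ((⟪p.1, p.2⟫ : ℝ) : EReal))

/-- The local functional `F(ρ) = ∫ f(ρ^ac) dx` with `f(t) = -t^α/α`, `α = 1 - 1/(n+q)`. -/
def Ffun (n : ℕ) (q : ℝ) (ρ : Measure (En n)) : EReal :=
  - ((∫⁻ x, ENNReal.ofReal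
      ((ρ.rnDeriv volume x).toReal ^ (1 - 1/((n : ℝ) + q)) / (1 - 1/((n : ℝ) + q)))
      ∂volume : ℝ≥0∞) : EReal)

/-- The functional `J(ρ) = F(ρ) + T(ρ,μ)`. -/
def Jfun (n : ℕ) (q : ℝ) (μ ρ : Measure (En n)) : EReal := Ffun n q ρ + Tcorr ρ μ

/-- Finite first moment. -/
def P1 {n : ℕ} (ρ : Measure (En n)) : Prop := Integrable (fun x : En n => ‖x‖) ρ

/-- `μ` is not supported on any affine hyperplane. -/
def NotHyperplane {n : ℕ} (μ : Measure (En n)) : Prop :=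
  ∀ (e : En n) (ℓ : ℝ), e ≠ 0 → μ {x | ⟪x, e⟫ = ℓ} ≠ 1


open ProbabilityTheory

lemma posPartNN_coe (r : ℝ) : posPartNN (r : EReal) = ENNReal.ofReal r := by
  simp [posPartNN]

lemma eInt_coe {X : Type*} [MeasurableSpace X] (ρ : Measure X) (f : X → ℝ) :
    eInt ρ (fun x => (f x : EReal)) =
      ((∫⁻ x, ENNReal.ofReal (f x) ∂ρ : ℝ≥0∞) : EReal)
        - ((∫⁻ x, ENNReal.ofReal (-f x) ∂ρ : ℝ≥0∞) : EReal) := by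
  simp only [eInt, ← EReal.coe_neg, posPartNN_coe]

lemma eInt_coe_eq_integral {X : Type*} [MeasurableSpace X] {ρ : Measure X} {f : X → ℝ}
    (hf : Integrable f ρ) :
    eInt ρ (fun x => (f x : EReal)) = ((∫ x, f x ∂ρ : ℝ) : EReal) := by
  have h₁ : ∫⁻ x, ENNReal.ofReal (f x) ∂ρ ≠ ⊤ := hf.lintegral_lt_top.ne
  have h₂ : ∫⁻ x, ENNReal.ofReal (-f x) ∂ρ ≠ ⊤ := hf.neg.lintegral_lt_top.ne
  rw [eInt_coe, integral_eq_lintegral_pos_part_sub_lintegral_neg_part hf, EReal.coe_sub,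
    EReal.coe_ennreal_toReal h₁, EReal.coe_ennreal_toReal h₂]

lemma eInt_coe_le_lintegral {X : Type*} [MeasurableSpace X] (ρ : Measure X) (f : X → ℝ) :
    eInt ρ (fun x => (f x : EReal)) ≤ ((∫⁻ x, ENNReal.ofReal (f x) ∂ρ : ℝ≥0∞) : EReal) := by
  rw [eInt_coe, sub_eq_add_neg]
  calc _ ≤ ((∫⁻ x, ENNReal.ofReal (f x) ∂ρ : ℝ≥0∞) : EReal) + 0 := by
        gcongr
        rw [EReal.neg_le, neg_zero]
        exact EReal.coe_ennreal_nonneg _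
    _ = _ := add_zero _

lemma P1.integrable_id {n : ℕ} {ρ : Measure (En n)} (h : P1 ρ) :
    Integrable (fun x : En n => x) ρ :=
  (integrable_norm_iff measurable_id.aestronglyMeasurable).1 h

/-- Testing with the independent coupling. -/
lemma Tcorr_nonneg {n : ℕ} {ρ μ : Measure (En n)} [IsProbabilityMeasure ρ]
    [IsProbabilityMeasure μ] (hρ : P1 ρ) (hμ : P1 μ) (hbar : ∫ y, y ∂μ = (0 : En n)) :
    0 ≤ Tcorr ρ μ := by
  have hint : Integrable (fun p : En n × En n => (⟪p.1, p.2⟫ : ℝ)) (ρ.prod μ) := by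
    refine (Integrable.mul_prod hρ hμ).mono
      (Continuous.aestronglyMeasurable (by fun_prop)) (.of_forall fun p => ?_)
    simpa using norm_inner_le_norm (𝕜 := ℝ) p.1 p.2
  have hzero : eInt (ρ.prod μ) (fun p => ((⟪p.1, p.2⟫ : ℝ) : EReal)) = 0 := by
    rw [eInt_coe_eq_integral hint, integral_prod _ hint]
    simp [integral_inner (𝕜 := ℝ) hμ.integrable_id, hbar]
  have hplan : ρ.prod μ ∈ Plans ρ μ := ⟨inferInstance, by simp, by simp⟩
  exact hzero ▸ le_iSup₂ (f := fun γ (_ : γ ∈ Plans ρ μ) =>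
    eInt γ (fun p => ((⟪p.1, p.2⟫ : ℝ) : EReal))) _ hplan

lemma Tcorr_le_of_norm_le {n : ℕ} {ρ μ : Measure (En n)} {r : ℝ} (hr : 0 ≤ r)
    (hρ : ∀ᵐ x ∂ρ, ‖x‖ ≤ r) (hμ : P1 μ) :
    Tcorr ρ μ ≤ ((r * ∫ y, ‖y‖ ∂μ : ℝ) : EReal) := by
  refine iSup₂_le fun γ ⟨_, h₁, h₂⟩ => (eInt_coe_le_lintegral _ _).trans ?_
  have hγ : ∀ᵐ p ∂γ, ‖p.1‖ ≤ r := by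
    rw [← h₁] at hρ
    exact ae_of_ae_map measurable_fst.aemeasurable hρ
  have key : ∫⁻ p, ENNReal.ofReal (⟪p.1, p.2⟫ : ℝ) ∂γ ≤
      ENNReal.ofReal (r * ∫ y, ‖y‖ ∂μ) := calc
    _ ≤ ∫⁻ p, ENNReal.ofReal (r * ‖p.2‖) ∂γ := by
      refine lintegral_mono_ae (hγ.mono fun p hp => ENNReal.ofReal_le_ofReal ?_)
      exact (real_inner_le_norm _ _).trans (by gcongr)
    _ = ∫⁻ y, ENNReal.ofReal (r * ‖y‖) ∂μ := by
      rw [← h₂, lintegral_map (by fun_prop) measurable_snd]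
    _ = ENNReal.ofReal (r * ∫ y, ‖y‖ ∂μ) := by
      rw [← integral_const_mul, ofReal_integral_eq_lintegral_ofReal (Integrable.const_mul hμ r)
        (.of_forall fun y => by positivity)]
  calc _ ≤ ((ENNReal.ofReal (r * ∫ y, ‖y‖ ∂μ) : ℝ≥0∞) : EReal) := by exact_mod_cast key
    _ = _ := by
      rw [EReal.coe_ennreal_ofReal, max_eq_left (mul_nonneg hr (by positivity))]

lemma one_sub_one_div_add_mem_Ioo (n : ℕ) {q : ℝ} (hq : 1 < q) :
    1 - 1 / ((n : ℝ) + q) ∈ Ioo (0 : ℝ) 1 := by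
  have hn : (0 : ℝ) ≤ n := n.cast_nonneg
  have h : 1 / ((n : ℝ) + q) < 1 := by
    rw [div_lt_one (by linarith)]
    linarith
  have h' : 0 < 1 / ((n : ℝ) + q) := by positivity
  constructor <;> linarith

lemma Ffun_eq_zero {n : ℕ} {q : ℝ} (hq : 1 < q) {ρ : Measure (En n)}
    (h : ρ.rnDeriv volume =ᵐ[(volume : Measure (En n))] 0) : Ffun n q ρ = 0 := by
  have hα := (one_sub_one_div_add_mem_Ioo n hq).1.ne'
  rw [Ffun, lintegral_congr_ae (g := fun _ => 0), lintegral_zero]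
  · simp
  · filter_upwards [h] with x hx
    rw [hx, Pi.zero_apply, ENNReal.toReal_zero, Real.zero_rpow hα, zero_div, ENNReal.ofReal_zero]

lemma Ffun_cond_le {n : ℕ} {q : ℝ} (hq : 1 < q) {s : Set (En n)} (hs : MeasurableSet s)
    (h₀ : volume s ≠ 0) (h₁ : volume s ≠ ⊤) :
    Ffun n q (volume[|s]) ≤ ((-(volume.real s) ^ (1 / ((n : ℝ) + q)) : ℝ) : EReal) := by
  obtain ⟨hα₀, hα₁⟩ := one_sub_one_div_add_mem_Ioo n hq
  have hV : 0 < volume.real s := ENNReal.toReal_pos h₀ h₁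
  have hd : (volume[|s] : Measure (En n)) =
      volume.withDensity (s.indicator fun _ => (volume s)⁻¹) := by
    rw [withDensity_indicator hs, withDensity_const, ProbabilityTheory.cond]
  have hrn : (volume[|s]).rnDeriv volume =ᵐ[volume] s.indicator fun _ => (volume s)⁻¹ := by
    rw [hd]
    exact Measure.rnDeriv_withDensity _ (measurable_const.indicator hs)
  have hF : ∫⁻ x, ENNReal.ofReal (((volume[|s]).rnDeriv volume x).toReal ^
      (1 - 1 / ((n : ℝ) + q)) / (1 - 1 / ((n : ℝ) + q))) =
      ENNReal.ofReal ((volume.real s) ^ (1 / ((n : ℝ) + q)) / (1 - 1 / ((n : ℝ) + q))) := by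
    rw [lintegral_congr_ae (g := s.indicator fun _ => ENNReal.ofReal
      ((volume.real s)⁻¹ ^ (1 - 1 / ((n : ℝ) + q)) / (1 - 1 / ((n : ℝ) + q)))),
      lintegral_indicator_const hs, ← ENNReal.ofReal_toReal h₁, ← ENNReal.ofReal_mul (by positivity)]
    · congr 1
      change _ / _ * volume.real s = _
      rw [Real.inv_rpow hV.le, ← Real.rpow_neg hV.le, div_mul_eq_mul_div]
      nth_rewrite 2 [← Real.rpow_one (volume.real s)]
      rw [← Real.rpow_add hV]
      ring_nf
    · filter_upwards [hrn] with x hx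
      rw [hx]
      by_cases hxs : x ∈ s
      · simp [hxs, Measure.real]
      · rw [indicator_of_notMem hxs, indicator_of_notMem hxs, ENNReal.toReal_zero,
          Real.zero_rpow hα₀.ne', zero_div, ENNReal.ofReal_zero]
  rw [Ffun, hF, EReal.coe_ennreal_ofReal, max_eq_left (by positivity), EReal.coe_neg,
    EReal.neg_le_neg_iff, EReal.coe_le_coe_iff]
  exact le_div_self (by positivity) hα₀ hα₁.le

lemma exists_pos_mul_lt_mul_rpow {a b p : ℝ} (hb : 0 < b) (hp : p < 1) :
    ∃ r : ℝ, 0 < r ∧ r * a < r ^ p * b := by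
  have hlim : Tendsto (fun r : ℝ => r ^ (1 - p) * a) (𝓝[>] 0) (𝓝 0) := by
    have : ContinuousAt (fun r : ℝ => r ^ (1 - p) * a) 0 :=
      (Real.continuousAt_rpow_const _ _ (Or.inr (by linarith))).mul_const a
    have h := this.tendsto
    rw [Real.zero_rpow (by linarith), zero_mul] at h
    exact h.mono_left nhdsWithin_le_nhds
  obtain ⟨r, hr, hr₀⟩ := ((hlim.eventually_lt_const hb).and self_mem_nhdsWithin).exists
  replace hr₀ : 0 < r := hr₀
  refine ⟨r, hr₀, ?_⟩
  calc r * a = r ^ p * (r ^ (1 - p) * a) := by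
        rw [← mul_assoc, ← Real.rpow_add hr₀, add_sub_cancel, Real.rpow_one]
    _ < r ^ p * b := by gcongr

/-- Uniform measures on small balls have negative energy. -/
lemma exists_Jfun_neg {n : ℕ} {q : ℝ} (hq : 1 < q) {μ : Measure (En n)} (hμ : P1 μ) :
    ∃ ρ : Measure (En n), IsProbabilityMeasure ρ ∧ P1 ρ ∧ Jfun n q μ ρ < 0 := by
  have hn : (0 : ℝ) ≤ n := n.cast_nonneg
  have hV : 0 < volume.real (Metric.ball (0 : En n) 1) :=
    ENNReal.toReal_pos (Metric.measure_ball_pos _ _ one_pos).ne' measure_ball_lt_top.ne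
  obtain ⟨r, hr, hlt⟩ := exists_pos_mul_lt_mul_rpow (a := ∫ y, ‖y‖ ∂μ)
    (b := volume.real (Metric.ball (0 : En n) 1) ^ (1 / ((n : ℝ) + q)))
    (p := n * (1 / ((n : ℝ) + q))) (by positivity)
    (by rw [mul_one_div, div_lt_one (by linarith)]; linarith)
  have hs : MeasurableSet (Metric.ball (0 : En n) r) := measurableSet_ball
  have h₀ : volume (Metric.ball (0 : En n) r) ≠ 0 := (Metric.measure_ball_pos _ _ hr).ne'
  have h₁ : volume (Metric.ball (0 : En n) r) ≠ ⊤ := measure_ball_lt_top.ne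
  have hvol : volume.real (Metric.ball (0 : En n) r) =
      r ^ (n : ℝ) * volume.real (Metric.ball (0 : En n) 1) := by
    rw [Measure.real, Measure.addHaar_ball_of_pos _ _ hr, ENNReal.toReal_mul,
      ENNReal.toReal_ofReal (by positivity), finrank_euclideanSpace_fin, Real.rpow_natCast,
      Measure.real]
  have hprob : IsProbabilityMeasure (volume[|Metric.ball (0 : En n) r]) :=
    cond_isProbabilityMeasure_of_finite h₀ h₁
  have hnorm : ∀ᵐ x ∂(volume[|Metric.ball (0 : En n) r]), ‖x‖ ≤ r := by
    filter_upwards [ae_cond_mem hs] with x hx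
    exact (mem_ball_zero_iff.1 hx).le
  refine ⟨volume[|Metric.ball (0 : En n) r], hprob, ?_, ?_⟩
  · exact .of_bound (by fun_prop) r (by simpa using hnorm)
  · have hle := Tcorr_le_of_norm_le hr.le hnorm hμ
    refine lt_of_le_of_lt (add_le_add (Ffun_cond_le hq hs h₀ h₁) hle) ?_
    rw [← EReal.coe_add, ← EReal.coe_zero, EReal.coe_lt_coe_iff, hvol,
      Real.mul_rpow (by positivity) hV.le, ← Real.rpow_mul hr.le]
    linarith

/-- The minimizer is not purely singular: its absolutely
continuous part does not vanish a.e. -/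
theorem qMomentMeasures_minimizer_not_singular
    (n : ℕ) (hn : 1 ≤ n) (q : ℝ) (hq : 1 < q)
    (μ : Measure (En n)) [IsProbabilityMeasure μ]
    (hμ1 : P1 μ) (hbar : ∫ y, y ∂μ = (0 : En n)) (hplane : NotHyperplane μ)
    (ρbar : Measure (En n)) [IsProbabilityMeasure ρbar] (hρ1 : P1 ρbar)
    (hmin : ∀ ρ : Measure (En n), IsProbabilityMeasure ρ → P1 ρ →
      Jfun n q μ ρbar ≤ Jfun n q μ ρ) :
    ¬ (ρbar.rnDeriv volume =ᵐ[(volume : Measure (En n))] 0) ∧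
      ¬ ρbar.MutuallySingular (volume : Measure (En n)) := by
  have hnot : ¬ (ρbar.rnDeriv volume =ᵐ[(volume : Measure (En n))] 0) := fun h => by
    obtain ⟨ρ, hρ, hρ1', hneg⟩ := exists_Jfun_neg hq hμ1
    refine ((hmin ρ hρ hρ1').trans_lt hneg).not_ge ?_
    rw [Jfun, Ffun_eq_zero hq h, zero_add]
    exact Tcorr_nonneg hρ1 hμ1 hbar
  exact ⟨hnot, fun h => hnot ((Measure.rnDeriv_eq_zero _ _).2 h)⟩

end
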